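/- Let G be a non-amenable finitely generated group. Then G is one-ended if and only if G does not have the finite-step retaining property. -/

import Mathlib

/-- The growth comparison relation: `f ≼ g` iff there is `C > 0` with
`f n ≤ C * g (C*n + C) + C` for all `n`. -/
def GrowthLE (f g : ℕ → ℕ) : Prop :=
  ∃ C : ℕ, 0 < C ∧ ∀ n, f n ≤ C * g (C * n + C) + C

/-- Equivalence of growth rates. -/
def GrowthEquiv (f g : ℕ → ℕ) : Prop := GrowthLE f g ∧ GrowthLE g f

/-- The growth function of a subset `U` of a metric space, with basepoint set `A`:
`n ↦ #(U ∩ B(A, n))`. -/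
noncomputable def relGrowth {X : Type*} [MetricSpace X] (U A : Set X) : ℕ → ℕ :=
  fun n => Set.ncard {x | x ∈ U ∧ ∃ a ∈ A, dist a x ≤ (n : ℝ)}

/-- A metric space is discrete and proper iff all balls (of integer radius) are finite. -/
def DiscreteProper (X : Type*) [MetricSpace X] : Prop :=
  ∀ (x : X) (n : ℕ), {y : X | dist x y ≤ (n : ℝ)}.Finite

/-- Uniformly proper: there is a uniform bound on cardinalities of all balls of radius `n`. -/
def UniformlyProper (X : Type*) [MetricSpace X] : Prop :=
  ∃ g : ℕ → ℕ, ∀ (x : X) (n : ℕ),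
    {y : X | dist x y ≤ (n : ℝ)}.Finite ∧ Set.ncard {y : X | dist x y ≤ (n : ℝ)} ≤ g n

/-- A `c`-quasi-isometry between metric spaces. -/
def IsQuasiIsometryMS {X Y : Type*} [MetricSpace X] [MetricSpace Y] (c : ℝ) (φ : X → Y) : Prop :=
  1 ≤ c ∧
  (∀ a b : X, dist a b / c - c ≤ dist (φ a) (φ b) ∧ dist (φ a) (φ b) ≤ c * dist a b + c) ∧
  (∀ y : Y, ∃ x : X, dist (φ x) y ≤ c)

/-- Growth function of `U ⊆ V(G)` (with the metric induced by the path-metric of `G`)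
with respect to basepoint set `A`. -/
noncomputable def graphGrowth {V : Type*} (G : SimpleGraph V) (U A : Set V) : ℕ → ℕ :=
  fun n => Set.ncard {v | v ∈ U ∧ ∃ a ∈ A, G.dist a v ≤ n}

/-- `Growth(U) = Growth(G)` for `U` a set of vertices of `G` with the induced metric. -/
def GrowthEqFull {V : Type*} (G : SimpleGraph V) (U : Set V) : Prop :=
  ∃ u₀ ∈ U, GrowthEquiv (graphGrowth G Set.univ {u₀}) (graphGrowth G U {u₀})

/-- The set of vertices protected up to (and including) time `n`. -/
def protectedUpTo {V : Type*} (W : ℕ → Set V) (n : ℕ) : Set V :=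
  ⋃ i ∈ Finset.Icc 1 n, W i

/-- The set of vertices on fire at time `n`, for fire reach `r`, strategy `W` and
initial fire `X0`: `X (n+1)` consists of vertices joined to `X n` by a path of length
at most `r` avoiding `(W 1 ∪ ⋯ ∪ W (n+1)) \ X n`. -/
def fireSet {V : Type*} (G : SimpleGraph V) (r : ℕ) (W : ℕ → Set V) (X0 : Set V) : ℕ → Set V
  | 0 => X0
  | n + 1 =>
    {v | ∃ u ∈ fireSet G r W X0 n, ∃ p : G.Walk u v, p.length ≤ r ∧
      ∀ x ∈ p.support, x ∉ protectedUpTo W (n + 1) \ fireSet G r W X0 n}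

/-- The set of vertices on fire at the end of the game. -/
def burnedSet {V : Type*} (G : SimpleGraph V) (r : ℕ) (W : ℕ → Set V) (X0 : Set V) : Set V :=
  ⋃ n, fireSet G r W X0 n

/-- An `{f n}`-strategy: at each time `n ≥ 1` at most `f n` vertices are protected. -/
def IsStrategyBound {V : Type*} (f : ℕ → ℕ) (W : ℕ → Set V) : Prop :=
  ∀ n, 1 ≤ n → (W n).Finite ∧ (W n).ncard ≤ f n

/-- A finite-step strategy protects no vertices after some finite time. -/
def FiniteStepStrategy {V : Type*} (W : ℕ → Set V) : Prop :=
  ∃ N, ∀ n, N ≤ n → W n = ∅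

/-- A retaining `({f n}, r)`-strategy for the initial fire `X0`. -/
def IsRetainingStrategy {V : Type*} (G : SimpleGraph V) (f : ℕ → ℕ) (r : ℕ)
    (X0 : Set V) (W : ℕ → Set V) : Prop :=
  IsStrategyBound f W ∧ GrowthEqFull G (burnedSet G r W X0)ᶜ

/-- The `({f n}, r)`-retaining property. -/
def RetainingProperty {V : Type*} (G : SimpleGraph V) (f : ℕ → ℕ) (r : ℕ) : Prop :=
  ∀ X0 : Set V, X0.Finite → ∃ W, IsRetainingStrategy G f r X0 W

/-- Polynomial retaining property of degree `d` (fire reach one). -/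
def PolyRetaining {V : Type*} (G : SimpleGraph V) (d : ℕ) : Prop :=
  ∃ K : ℕ, 0 < K ∧ RetainingProperty G (fun n => K * n ^ d) 1

/-- The finite-step `{f n}`-retaining property (fire reach one). -/
def FiniteStepRetainingProperty {V : Type*} (G : SimpleGraph V) (f : ℕ → ℕ) : Prop :=
  ∀ X0 : Set V, X0.Finite → ∃ W, IsRetainingStrategy G f 1 X0 W ∧ FiniteStepStrategy W

/-- The finite-step polynomial retaining property of degree `d`. -/
def FiniteStepPolyRetaining {V : Type*} (G : SimpleGraph V) (d : ℕ) : Prop :=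
  ∃ K : ℕ, 0 < K ∧ FiniteStepRetainingProperty G (fun n => K * n ^ d)

/-- The `({f n}, r)`-containment property. -/
def ContainmentProperty {V : Type*} (G : SimpleGraph V) (f : ℕ → ℕ) (r : ℕ) : Prop :=
  ∀ X0 : Set V, X0.Finite →
    ∃ W, IsStrategyBound f W ∧ (burnedSet G r W X0).Finite

/-- Polynomial containment property of degree `d` (fire reach one). -/
def PolyContainment {V : Type*} (G : SimpleGraph V) (d : ℕ) : Prop :=
  ∃ K : ℕ, 0 < K ∧ ContainmentProperty G (fun n => K * n ^ d) 1

/-- The constant containment property. -/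
def ConstantContainment {V : Type*} (G : SimpleGraph V) : Prop := PolyContainment G 0

/-- `D` is (the vertex set of) a connected component of `G \ K`. -/
def ComponentAvoiding {V : Type*} (G : SimpleGraph V) (K D : Set V) : Prop :=
  D.Nonempty ∧ D ⊆ Kᶜ ∧
  (∀ u ∈ D, ∀ v ∈ D, ∃ p : G.Walk u v, ∀ x ∈ p.support, x ∉ K) ∧
  (∀ u ∈ D, ∀ v : V, v ∉ K → (∃ p : G.Walk u v, ∀ x ∈ p.support, x ∉ K) → v ∈ D)

/-- A deep component of `G \ K`: not contained in any bounded neighborhood of `K`. -/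
def IsDeepComponent {V : Type*} (G : SimpleGraph V) (K D : Set V) : Prop :=
  ComponentAvoiding G K D ∧ ∀ r : ℕ, ¬ D ⊆ {v | ∃ k ∈ K, G.dist k v ≤ r}

/-- An unbounded component of `G \ K`. -/
def IsUnboundedComponent {V : Type*} (G : SimpleGraph V) (K D : Set V) : Prop :=
  ComponentAvoiding G K D ∧ ∀ (v : V) (r : ℕ), ¬ D ⊆ {u | G.dist v u ≤ r}

/-- Uniformly locally finite graph: vertex degrees are bounded. -/
def UnifLocFinite {V : Type*} (G : SimpleGraph V) : Prop :=
  ∃ M : ℕ, ∀ v : V, (G.neighborSet v).Finite ∧ (G.neighborSet v).ncard ≤ M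

/-- Locally finite graph. -/
def LocFinite {V : Type*} (G : SimpleGraph V) : Prop := ∀ v : V, (G.neighborSet v).Finite

/-- A `c`-quasi-isometry between two connected graphs (with their path-metrics). -/
def GraphQI {V V' : Type*} (c : ℝ) (G : SimpleGraph V) (H : SimpleGraph V') (φ : V → V') : Prop :=
  1 ≤ c ∧
  (∀ a b : V, (G.dist a b : ℝ) / c - c ≤ (H.dist (φ a) (φ b) : ℝ) ∧
    (H.dist (φ a) (φ b) : ℝ) ≤ c * (G.dist a b : ℝ) + c) ∧
  (∀ y : V', ∃ x : V, (H.dist (φ x) y : ℝ) ≤ c)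

/-- The Cayley graph of a group with respect to a set `S`. -/
def cayley (G : Type) [Group G] (S : Set G) : SimpleGraph G :=
  SimpleGraph.fromRel (fun a b => a⁻¹ * b ∈ S)

/-- `S` is a finite generating set. -/
def IsFiniteGenSet {G : Type} [Group G] (S : Set G) : Prop :=
  S.Finite ∧ Subgroup.closure S = ⊤

/-- The ball of radius `n` around the identity for the word metric w.r.t. `T`. -/
def wordBall {G : Type} [Group G] (T : Set G) (n : ℕ) : Set G :=
  {g | ∃ l : List G, (∀ x ∈ l, x ∈ T ∨ x⁻¹ ∈ T) ∧ l.length ≤ n ∧ l.prod = g}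

/-- The word metric w.r.t. `T`. -/
noncomputable def wordDist {G : Type} [Group G] (T : Set G) (x y : G) : ℕ :=
  sInf {n | x⁻¹ * y ∈ wordBall T n}

/-- `G` is an amalgamated product `A ∗_C B` with `C` a proper subgroup of both factors,
where `C` corresponds to the given subgroup. -/
def SplitsOverAmalgam (G : Type) [Group G] (C : Subgroup G) : Prop :=
  ∃ (Gi : Bool → Type) (_ : ∀ i, Group (Gi i)) (K : Type) (_ : Group K)
    (φ : ∀ i, K →* Gi i),
    (∀ i, Function.Injective (φ i)) ∧ (∀ i, ¬ Function.Surjective (φ i)) ∧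
    ∃ e : G ≃* Monoid.PushoutI φ,
      C = Subgroup.comap e.toMonoidHom (Monoid.PushoutI.base φ).range

/-- `G` is an HNN-extension over the given subgroup `C`. -/
def SplitsOverHNN (G : Type) [Group G] (C : Subgroup G) : Prop :=
  ∃ (H : Type) (_ : Group H) (A B : Subgroup H) (φ : A ≃* B)
    (e : G ≃* HNNExtension H A B φ),
    C = Subgroup.comap e.toMonoidHom
      (Subgroup.map (HNNExtension.of : H →* HNNExtension H A B φ) A)

/-- `G` splits over `C`: amalgamated product with `C` proper in both factors,
or HNN-extension over `C`. -/
def SplitsOver (G : Type) [Group G] (C : Subgroup G) : Prop :=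
  SplitsOverAmalgam G C ∨ SplitsOverHNN G C

/-- Amenability of a (discrete) group: existence of a left-invariant, finitely
additive probability measure defined on all subsets. -/
def IsAmenable (G : Type) [Group G] : Prop :=
  ∃ m : Set G → ℝ, (∀ A : Set G, 0 ≤ m A) ∧ m Set.univ = 1 ∧
    (∀ A B : Set G, Disjoint A B → m (A ∪ B) = m A + m B) ∧
    (∀ (g : G) (A : Set G), m ((g * ·) '' A) = m A)


namespace SimpleGraph

section Dist

variable {V : Type*} {Γ : SimpleGraph V}

/-- In a connected graph, every vertex `x ≠ o` has a neighbour one step closer to `o`. -/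
lemma Connected.exists_adj_dist_eq (hc : Γ.Connected) {o x : V} {n : ℕ}
    (h : Γ.dist o x = n + 1) : ∃ y, Γ.Adj x y ∧ Γ.dist o y = n := by
  obtain ⟨p, hp⟩ := hc.exists_walk_length_eq_dist x o
  rw [dist_comm, h] at hp
  cases p with
  | nil => simp at hp
  | cons hxy q =>
    rename_i y
    refine ⟨y, hxy, ?_⟩
    rw [Walk.length_cons] at hp
    have h1 := Γ.dist_le q
    have h2 := hc.dist_triangle (u := o) (v := y) (w := x)
    have h3 : Γ.dist y x = 1 := dist_eq_one_iff_adj.mpr hxy.symm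
    rw [dist_comm] at h1
    omega

/-- Balls in a connected locally finite graph are finite. -/
lemma Connected.finite_ball (hc : Γ.Connected) (hl : LocFinite Γ) (o : V) (n : ℕ) :
    {v | Γ.dist o v ≤ n}.Finite := by
  induction n with
  | zero =>
    refine (Set.finite_singleton o).subset fun v hv => ?_
    have : Γ.dist o v = 0 := Nat.le_zero.mp hv
    exact ((hc.dist_eq_zero_iff).mp this).symm
  | succ n ih =>
    refine (ih.union (ih.biUnion fun y _ => hl y)).subset fun v hv => ?_
    rcases Nat.lt_or_ge n (Γ.dist o v) with h | h
    · obtain ⟨y, hy, hd⟩ := hc.exists_adj_dist_eq (show Γ.dist o v = n + 1 from le_antisymm hv h)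
      exact Or.inr (Set.mem_biUnion (show y ∈ {v | Γ.dist o v ≤ n} from hd.le) hy.symm)
    · exact Or.inl h

/-- An infinite set is unbounded. -/
lemma Connected.exists_dist_gt (hc : Γ.Connected) (hl : LocFinite Γ) (o : V) {D : Set V}
    (hD : D.Infinite) (n : ℕ) : ∃ x ∈ D, n < Γ.dist o x := by
  by_contra! h
  exact hD ((hc.finite_ball hl o n).subset h)

/-- A finite set is bounded. -/
lemma exists_dist_le_of_finite (Γ : SimpleGraph V) (o : V) {D : Set V} (hD : D.Finite) :
    ∃ n, ∀ x ∈ D, Γ.dist o x ≤ n := by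
  obtain ⟨n, hn⟩ := (hD.image (Γ.dist o)).bddAbove
  exact ⟨n, fun x hx => hn (Set.mem_image_of_mem _ hx)⟩

end Dist

/-- `D` can only be left through `K`: a neighbour of a vertex of `D` lies in `D` or in `K`. -/
def ClosedOff {V : Type*} (Γ : SimpleGraph V) (K D : Set V) : Prop :=
  ∀ ⦃u v⦄, u ∈ D → Γ.Adj u v → v ∉ K → v ∈ D

section ClosedOff

variable {V : Type*} {Γ : SimpleGraph V} {K D : Set V}

lemma ComponentCompl.closedOff (C : Γ.ComponentCompl K) : Γ.ClosedOff K C :=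
  fun _ _ hu huv hv => mem_of_adj _ _ hu hv huv

/-- A set closed off by `K` that meets a ball disjoint from `K` contains the centre. -/
lemma ClosedOff.center_mem (h : Γ.ClosedOff K D) (hc : Γ.Connected) {o : V} {n : ℕ}
    (hK : ∀ v ∈ K, n < Γ.dist o v) {y : V} (hy : y ∈ D) (hyn : Γ.dist o y ≤ n) : o ∈ D := by
  induction hm : Γ.dist o y generalizing y with
  | zero => rwa [(hc.dist_eq_zero_iff).mp hm]
  | succ m ih =>
    obtain ⟨z, hyz, hz⟩ := hc.exists_adj_dist_eq hm
    exact ih (h hy hyz fun hzK => by have := hK z hzK; omega) (by omega) hz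

/-- A set closed off by `K` contains every ball disjoint from `K` centred at one of its points. -/
lemma ClosedOff.ball_subset (h : Γ.ClosedOff K D) (hc : Γ.Connected) {o : V} {n : ℕ}
    (hK : ∀ v ∈ K, n < Γ.dist o v) (ho : o ∈ D) : {v | Γ.dist o v ≤ n} ⊆ D := by
  intro y hyn
  induction hm : Γ.dist o y generalizing y with
  | zero => rwa [← (hc.dist_eq_zero_iff).mp hm]
  | succ m ih =>
    obtain ⟨z, hyz, hz⟩ := hc.exists_adj_dist_eq hm
    have hyn' : Γ.dist o y ≤ n := hyn
    exact h (ih (show Γ.dist o z ≤ n by omega) hz) hyz.symm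
      fun hyK => by have := hK y hyK; omega

/-- An infinite set closed off by a subset of a ball meets every sphere outside of the ball. -/
lemma ClosedOff.exists_dist_eq (h : Γ.ClosedOff K D) (hc : Γ.Connected) (hl : LocFinite Γ)
    (hD : D.Infinite) {o : V} {r m : ℕ} (hK : ∀ v ∈ K, Γ.dist o v ≤ r) (hm : r < m) :
    ∃ x ∈ D, Γ.dist o x = m := by
  obtain ⟨x, hx, hmx⟩ := hc.exists_dist_gt hl o hD m
  obtain ⟨j, hj⟩ := Nat.exists_eq_add_of_le hmx.le
  clear hmx
  induction j generalizing x with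
  | zero => exact ⟨x, hx, hj⟩
  | succ j ih =>
    obtain ⟨y, hxy, hy⟩ := hc.exists_adj_dist_eq (show Γ.dist o x = (m + j) + 1 by omega)
    exact ih y (h hx hxy fun hyK => by have := hK y hyK; omega) hy

/-- A vertex set containing an infinite set that is closed off by a finite set contains arbitrarily
large balls at linearly bounded distance. If all balls of the same radius have the same
cardinality, it therefore has full growth. -/
lemma ClosedOff.growthEqFull (h : Γ.ClosedOff K D) (hc : Γ.Connected) (hl : LocFinite Γ)
    (hball : ∀ x y n, {v | Γ.dist x v ≤ n}.ncard = {v | Γ.dist y v ≤ n}.ncard)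
    (hK : K.Finite) (hD : D.Infinite) {U : Set V} (hDU : D ⊆ U) : GrowthEqFull Γ U := by
  obtain ⟨u, hu⟩ := hD.nonempty
  obtain ⟨r, hr⟩ := Γ.exists_dist_le_of_finite u hK
  refine ⟨u, hDU hu, ⟨r + 3, by omega, fun n => ?_⟩, ⟨1, one_pos, fun n => ?_⟩⟩
  · obtain ⟨x, hx, hux⟩ := h.exists_dist_eq hc hl hD hr (show r < r + n + 1 by omega)
    have hsub : {v | Γ.dist x v ≤ n} ⊆ D := h.ball_subset hc (fun v hv => by
      have := hr v hv
      have := hc.dist_triangle (u := u) (v := v) (w := x)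
      rw [Γ.dist_comm (u := v)] at this
      omega) hx
    have hle : graphGrowth Γ Set.univ {u} n ≤ graphGrowth Γ U {u} ((r + 3) * n + (r + 3)) := by
      simp only [graphGrowth, Set.mem_univ, Set.mem_singleton_iff, exists_eq_left, true_and]
      rw [hball u x n]
      refine Set.ncard_le_ncard (fun v hv => ⟨hDU (hsub hv), ?_⟩)
        ((hc.finite_ball hl u _).subset fun v hv => hv.2)
      have := hc.dist_triangle (u := u) (v := x) (w := v)
      have hv' : Γ.dist x v ≤ n := hv
      nlinarith
    nlinarith
  · have hle : graphGrowth Γ U {u} n ≤ graphGrowth Γ Set.univ {u} (1 * n + 1) := by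
      simp only [graphGrowth, Set.mem_univ, Set.mem_singleton_iff, exists_eq_left, true_and]
      refine Set.ncard_le_ncard (fun v hv => ?_) (hc.finite_ball hl u _)
      have := hv.2
      exact show Γ.dist u v ≤ 1 * n + 1 by omega
    omega

end ClosedOff

section Ends

open CategoryTheory

variable {V : Type} {Γ : SimpleGraph V}

/-- Every infinite component of the complement of a finite set is chosen by some end. -/
lemma exists_end_apply_eq [Γ.LocallyFinite] [Fact Γ.Preconnected] [Infinite V] {K : Finset V}
    (C : Γ.ComponentCompl K) (hC : C.supp.Infinite) :
    ∃ e ∈ Γ.end, e (Opposite.op K) = C := by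
  have hml : Γ.componentComplFunctor.IsMittagLeffler :=
    Γ.componentComplFunctor.isMittagLeffler_of_exists_finite_range
      fun j => ⟨j, 𝟙 j, Set.toFinite _⟩
  have := Γ.componentComplFunctor.toEventualRanges_nonempty hml
  obtain ⟨s, hs⟩ := Γ.componentComplFunctor.toEventualRanges.eval_section_surjective_of_surjective
    (Γ.componentComplFunctor.surjective_toEventualRanges hml) (Opposite.op K)
    ⟨C, (Γ.infinite_iff_in_eventualRange (K := Opposite.op K) C).mp hC⟩
  exact ⟨_, (Γ.componentComplFunctor.toEventualRangesSectionsEquiv s).2,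
    congrArg Subtype.val hs⟩

/-- In a graph with one end, a vertex set whose outer boundary is finite is finite or cofinite. -/
lemma finite_or_finite_compl_of_ncard_end_eq_one [Γ.LocallyFinite] [Fact Γ.Preconnected]
    [Infinite V] (h : Γ.end.ncard = 1) {P B : Set V} (hP : P.Finite) (hB : Γ.ClosedOff P B) :
    B.Finite ∨ Bᶜ.Finite := by
  obtain ⟨K, rfl⟩ := hP.exists_finset_coe
  have key : ∀ A : Set V, Γ.ClosedOff K A → A.Infinite →
      ∃ C : Γ.ComponentCompl K, C.supp.Infinite ∧ C.supp ⊆ A := by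
    intro A hA hinf
    have hinf' : (A \ K).Infinite := hinf.sdiff K.finite_toSet
    have := hinf'.to_subtype
    obtain ⟨C, hC⟩ := Finite.exists_infinite_fiber
      fun x : (A \ K : Set V) => Γ.componentComplMk x.2.2
    have hfib := Set.infinite_coe_iff.mp hC
    refine ⟨C, (hfib.image Subtype.val_injective.injOn).mono ?_, ?_⟩
    · rintro _ ⟨x, hx, rfl⟩
      exact ⟨x.2.2, hx⟩
    · obtain ⟨⟨x, hxA, hxK⟩, hx⟩ := hfib.nonempty
      rintro v ⟨hv, hvC⟩
      have hr : (Γ.induce (K : Set V)ᶜ).Reachable ⟨x, hxK⟩ ⟨v, hv⟩ :=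
        ConnectedComponent.exact (Eq.trans hx hvC.symm)
      obtain ⟨p⟩ := hr
      have walk : ∀ {a b : ((K : Set V)ᶜ : Set V)}, (Γ.induce (K : Set V)ᶜ).Walk a b →
          (a : V) ∈ A → (b : V) ∈ A := by
        intro a b p
        induction p with
        | nil => exact id
        | @cons a w b hab _ ih => exact fun ha => ih (hA ha hab w.2)
      exact walk p hxA
  by_contra! hcon
  obtain ⟨C, hCinf, hC⟩ := key B hB hcon.1
  have hB' : Γ.ClosedOff K (Bᶜ \ K) := fun u v hu huv hv =>
    ⟨fun hvB => hu.1 (hB hvB huv.symm hu.2), hv⟩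
  obtain ⟨C', hCinf', hC'⟩ := key _ hB' (hcon.2.sdiff K.finite_toSet)
  obtain ⟨e, he, heC⟩ := exists_end_apply_eq C hCinf
  obtain ⟨e', he', heC'⟩ := exists_end_apply_eq C' hCinf'
  obtain ⟨e₀, he₀⟩ := Set.ncard_eq_one.mp h
  rw [he₀, Set.mem_singleton_iff] at he he'
  subst he he'
  obtain rfl : C = C' := heC.symm.trans heC'
  obtain ⟨x, hx⟩ := hCinf.nonempty
  exact (hC' hx).1 (hC hx)

/-- If a locally finite connected infinite graph does not have exactly one end, some finite set
separates two infinite components of its complement. -/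
lemma exists_ne_infinite_componentCompl [Γ.LocallyFinite] [Fact Γ.Preconnected] [Infinite V]
    (h : Γ.end.ncard ≠ 1) :
    ∃ (K : Finset V) (C C' : Γ.ComponentCompl K), C ≠ C' ∧ C.supp.Infinite ∧ C'.supp.Infinite := by
  obtain ⟨e, he⟩ := Γ.nonempty_ends_of_infinite
  have : ∃ e' ∈ Γ.end, e' ≠ e := by
    by_contra! hall
    exact h (Set.ncard_eq_one.mpr ⟨e, Set.eq_singleton_iff_unique_mem.mpr ⟨he, hall⟩⟩)
  obtain ⟨e', he', hne⟩ := this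
  obtain ⟨K, hK⟩ := Function.ne_iff.mp hne
  exact ⟨K.unop, e' K, e K, hK, Γ.end_componentCompl_infinite ⟨e', he'⟩ K,
    Γ.end_componentCompl_infinite ⟨e, he⟩ K⟩

end Ends

end SimpleGraph

section Isoperimetry

open scoped Pointwise ENNReal symmDiff
open MeasureTheory Filter Topology

variable {G : Type} [Group G]

open scoped Classical in
/-- Right translation by a fixed element moves a number of elements out of `F` that is bounded
linearly in the size of the outer boundary of `F`. -/
lemma exists_card_mul_singleton_sdiff_le {S : Set G} (hS : Subgroup.closure S = ⊤) {T : Finset G}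
    (hST : S ⊆ T) (g : G) :
    ∃ c : ℕ, ∀ F : Finset G, ((F * {g}) \ F).card ≤ c * ((F * T) \ F).card := by
  have hg : g ∈ Subgroup.closure S := hS ▸ Subgroup.mem_top g
  induction hg using Subgroup.closure_induction with
  | mem s hs =>
    refine ⟨1, fun F => ?_⟩
    rw [one_mul]
    exact Finset.card_le_card (Finset.sdiff_subset_sdiff
      (Finset.mul_subset_mul_left (Finset.singleton_subset_iff.mpr (hST hs))) subset_rfl)
  | one => exact ⟨0, fun F => by simp [Finset.singleton_one]⟩
  | mul g h _ _ hg hh =>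
    obtain ⟨c, hc⟩ := hg
    obtain ⟨d, hd⟩ := hh
    refine ⟨c + d, fun F => ?_⟩
    have hsub : (F * {g * h}) \ F ⊆ ((F * {g}) \ F) * {h} ∪ ((F * {h}) \ F) := by
      intro x hx
      simp only [Finset.mem_sdiff, Finset.mem_union, Finset.mem_mul, Finset.mem_singleton,
        exists_eq_left] at hx ⊢
      obtain ⟨⟨a, ha, rfl⟩, hx⟩ := hx
      by_cases hag : a * g ∈ F
      · exact Or.inr ⟨⟨a * g, hag, mul_assoc ..⟩, hx⟩
      · exact Or.inl ⟨a * g, ⟨⟨a, ha, rfl⟩, hag⟩, mul_assoc ..⟩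
    calc _ ≤ _ := Finset.card_le_card hsub
      _ ≤ _ := Finset.card_union_le _ _
      _ ≤ _ := by
        rw [Finset.card_mul_singleton, add_mul]
        exact add_le_add (hc F) (hd F)
  | inv g _ hg =>
    obtain ⟨c, hc⟩ := hg
    refine ⟨c, fun F => ?_⟩
    have h1 : ((F * {g⁻¹}) \ F).card = (F \ (F * {g})).card := by
      rw [← Finset.card_mul_singleton ((F * {g⁻¹}) \ F) g]
      congr 1
      ext x
      simp [Finset.mul_singleton, Finset.smul_finset_sdiff]
    rw [h1, ← Finset.card_sdiff_comm (Finset.card_mul_singleton F g)]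
    exact hc F

open scoped Classical in
lemma card_smul_inv_symmDiff_inv (g : G) (F : Finset G) :
    ((g • F⁻¹) ∆ F⁻¹).card = 2 * ((F * {g⁻¹}) \ F).card := by
  have h : (g • F⁻¹) ∆ F⁻¹ = ((F * {g⁻¹}) ∆ F)⁻¹ := by
    ext x
    simp [Finset.mem_symmDiff, Finset.mul_singleton, ← Finset.inv_smul_mem_iff]
  rw [h, Finset.card_inv, symmDiff_def, Finset.sup_eq_union,
    Finset.card_union_of_disjoint disjoint_sdiff_sdiff,
    ← Finset.card_sdiff_comm (Finset.card_mul_singleton F g⁻¹), two_mul]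

open scoped Classical in
/-- Isoperimetric inequality in a non-amenable group. -/
lemma exists_card_le_mul_card_boundary (hna : ¬ IsAmenable G) {S : Set G}
    (hS : Subgroup.closure S = ⊤) {T : Finset G} (hST : S ⊆ T) :
    ∃ k : ℕ, ∀ F : Finset G, F.card ≤ k * ((F * T) \ F).card := by
  by_contra! hcon
  choose F hF using hcon
  let _ : MeasurableSpace G := ⊤
  have _ : SMulInvariantMeasure G G (Measure.count : Measure G) :=
    ⟨fun c s _ => by
      rw [Set.preimage_smul, Measure.count_apply .of_discrete, Measure.count_apply .of_discrete,
        ← Set.image_smul, (MulAction.injective (c⁻¹)).encard_image]⟩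
  have hfoel : IsFoelner G Measure.count atTop fun n => (((F n)⁻¹ : Finset G) : Set G) :=
    { eventually_measurableSet := .of_forall fun _ => .of_discrete
      eventually_meas_ne_zero := .of_forall fun n => by
        have : 0 < (F n).card := (Nat.zero_le _).trans_lt (hF n)
        rw [Measure.count_apply_finset, Finset.card_inv]
        exact_mod_cast this.ne'
      eventually_meas_ne_top := .of_forall fun n => by
        rw [Measure.count_apply_finset]
        exact ENNReal.natCast_ne_top _
      tendsto_meas_smul_symmDiff := fun g => by
        obtain ⟨c, hc⟩ := exists_card_mul_singleton_sdiff_le hS hST g⁻¹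
        have hlim : Tendsto (fun n : ℕ => (2 * c : ℝ≥0∞) * (n : ℝ≥0∞)⁻¹) atTop (𝓝 0) := by
          simpa using ENNReal.Tendsto.const_mul ENNReal.tendsto_inv_nat_nhds_zero
            (Or.inr (by finiteness))
        refine tendsto_of_tendsto_of_tendsto_of_le_of_le' tendsto_const_nhds hlim
          (.of_forall fun _ => zero_le) ?_
        filter_upwards [eventually_ge_atTop 1] with n hn
        rw [← Finset.coe_smul_finset, ← Finset.coe_symmDiff, Measure.count_apply_finset,
          Measure.count_apply_finset, Finset.card_inv, card_smul_inv_symmDiff_inv]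
        refine ENNReal.div_le_of_le_mul ?_
        have h0 : (n : ℝ≥0∞) ≠ 0 := by exact_mod_cast (Nat.one_le_iff_ne_zero.mp hn)
        calc ((2 * ((F n * {g⁻¹}) \ F n).card : ℕ) : ℝ≥0∞)
            ≤ ((2 * (c * ((F n * T) \ F n).card) : ℕ) : ℝ≥0∞) := by
              exact_mod_cast Nat.mul_le_mul_left 2 (hc (F n))
          _ = 2 * c * (n : ℝ≥0∞)⁻¹ * ((n * ((F n * T) \ F n).card : ℕ) : ℝ≥0∞) := by
              push_cast
              rw [mul_assoc (2 * c : ℝ≥0∞), ← mul_assoc (n : ℝ≥0∞)⁻¹,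
                ENNReal.inv_mul_cancel h0 (ENNReal.natCast_ne_top n), one_mul, mul_assoc]
          _ ≤ _ := by gcongr; exact (hF n).le }
  obtain ⟨m, hm1, hmadd, hminv⟩ := hfoel.amenable
  have hm : ∀ A, m A ≠ ∞ := fun A => by
    have h := hmadd A Aᶜ .of_discrete disjoint_compl_right
    rw [Set.union_compl_self, hm1] at h
    exact ne_top_of_le_ne_top ENNReal.one_ne_top (h ▸ le_self_add)
  refine hna ⟨fun A => (m A).toReal, fun A => ENNReal.toReal_nonneg, by simp [hm1],
    fun A B hAB => ?_, fun g A => congrArg ENNReal.toReal (hminv g A)⟩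
  simp only [hmadd A B .of_discrete hAB, ENNReal.toReal_add (hm A) (hm B)]

end Isoperimetry

section Fire

variable {V : Type*} {Γ : SimpleGraph V} {W : ℕ → Set V} {X0 : Set V}

lemma mem_protectedUpTo {n : ℕ} {v : V} :
    v ∈ protectedUpTo W n ↔ ∃ i, 1 ≤ i ∧ i ≤ n ∧ v ∈ W i := by
  simp [protectedUpTo, and_assoc]

lemma IsStrategyBound.protectedUpTo_finite_ncard_le {f : ℕ}
    (h : IsStrategyBound (fun _ => f) W) (n : ℕ) :
    (protectedUpTo W n).Finite ∧ (protectedUpTo W n).ncard ≤ f * n := by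
  induction n with
  | zero => simp [protectedUpTo]
  | succ n ih =>
    have heq : protectedUpTo W (n + 1) = protectedUpTo W n ∪ W (n + 1) := by
      ext v
      simp only [mem_protectedUpTo, Set.mem_union]
      refine ⟨fun ⟨i, h1, hi, hv⟩ => ?_, ?_⟩
      · rcases Nat.le_succ_iff.mp hi with hi | rfl
        · exact Or.inl ⟨i, h1, hi, hv⟩
        · exact Or.inr hv
      · rintro (⟨i, h1, hi, hv⟩ | hv)
        · exact ⟨i, h1, by omega, hv⟩
        · exact ⟨n + 1, by omega, le_rfl, hv⟩
    obtain ⟨hfin, hcard⟩ := h (n + 1) (by omega)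
    rw [heq]
    refine ⟨ih.1.union hfin, (Set.ncard_union_le _ _).trans ?_⟩
    rw [mul_add, mul_one]
    exact add_le_add ih.2 hcard

lemma fireSet_subset_succ (n : ℕ) : fireSet Γ 1 W X0 n ⊆ fireSet Γ 1 W X0 (n + 1) :=
  fun v hv => ⟨v, hv, .nil, Nat.zero_le _, fun x hx hxP => by
    rw [SimpleGraph.Walk.support_nil, List.mem_singleton] at hx
    exact hxP.2 (hx ▸ hv)⟩

lemma mem_fireSet_succ_of_adj {n : ℕ} {u v : V} (hu : u ∈ fireSet Γ 1 W X0 n)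
    (huv : Γ.Adj u v) (hv : v ∉ protectedUpTo W (n + 1)) : v ∈ fireSet Γ 1 W X0 (n + 1) :=
  ⟨u, hu, huv.toWalk, by simp, fun x hx hxP => by
    simp only [SimpleGraph.Walk.support_cons, SimpleGraph.Walk.support_nil, List.mem_cons,
      List.not_mem_nil, or_false] at hx
    rcases hx with rfl | rfl
    · exact hxP.2 hu
    · exact hv hxP.1⟩

/-- The fire is only ever stopped by protected vertices. -/
lemma closedOff_burnedSet {P : Set V} (hP : ∀ n, protectedUpTo W n ⊆ P) :
    Γ.ClosedOff P (burnedSet Γ 1 W X0) := by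
  intro u v hu huv hv
  obtain ⟨n, hn⟩ := Set.mem_iUnion.mp hu
  exact Set.mem_iUnion.mpr ⟨n + 1, mem_fireSet_succ_of_adj hn huv fun h => hv (hP _ h)⟩

/-- A finite-step strategy only protects finitely many vertices. -/
lemma FiniteStepStrategy.exists_finite_protectedUpTo_subset (hW : FiniteStepStrategy W) {f : ℕ}
    (hf : IsStrategyBound (fun _ => f) W) :
    ∃ P : Set V, P.Finite ∧ ∀ n, protectedUpTo W n ⊆ P := by
  obtain ⟨N, hN⟩ := hW
  refine ⟨protectedUpTo W N, (hf.protectedUpTo_finite_ncard_le N).1, fun n v hv => ?_⟩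
  obtain ⟨i, h1, -, hv⟩ := mem_protectedUpTo.mp hv
  refine mem_protectedUpTo.mpr ⟨i, h1, ?_, hv⟩
  by_contra! hi
  rw [hN i hi.le] at hv
  exact hv

/-- If the only protected vertices are those of `K`, from the first step on, then a set closed off
by `K` and away from the initial fire never burns. -/
lemma SimpleGraph.ClosedOff.subset_compl_burnedSet {K D : Set V} (h : Γ.ClosedOff K D)
    (hW : ∀ n, protectedUpTo W (n + 1) = K) (hK : Disjoint X0 K) (hD : Disjoint X0 D) :
    D ⊆ (burnedSet Γ 1 W X0)ᶜ := by
  have key : ∀ n, ∀ v ∈ fireSet Γ 1 W X0 n, v ∉ K ∧ v ∉ D := by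
    intro n
    induction n with
    | zero =>
      exact fun v hv => ⟨Set.disjoint_left.mp hK hv, Set.disjoint_left.mp hD hv⟩
    | succ n ih =>
      rintro v ⟨u, hu, p, hp, hsupp⟩
      have hvK : v ∉ K := fun hvK =>
        hsupp v p.end_mem_support ⟨(hW n).symm ▸ hvK, fun hv => (ih v hv).1 hvK⟩
      refine ⟨hvK, fun hvD => ?_⟩
      cases p with
      | nil => exact (ih _ hu).2 hvD
      | cons huw q =>
        cases q with
        | nil => exact (ih _ hu).2 (h hvD huw.symm (ih _ hu).1)
        | cons _ _ =>
          simp only [SimpleGraph.Walk.length_cons] at hp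
          omega
  intro v hvD hv
  obtain ⟨n, hn⟩ := Set.mem_iUnion.mp hv
  exact (key n v hn).2 hvD

/-- A set of full growth in an infinite graph with finite balls is infinite. -/
lemma GrowthEqFull.infinite [Infinite V] (hc : Γ.Connected) (hl : LocFinite Γ) {U : Set V}
    (h : GrowthEqFull Γ U) : U.Infinite := by
  intro hU
  obtain ⟨u, -, ⟨C, -, hC⟩, -⟩ := h
  obtain ⟨A, hA⟩ := Infinite.exists_subset_card_eq V (C * U.ncard + C + 1)
  obtain ⟨n, hn⟩ := Γ.exists_dist_le_of_finite u A.finite_toSet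
  have h1 : A.card ≤ graphGrowth Γ Set.univ {u} n := by
    rw [← Set.ncard_coe_finset]
    simp only [graphGrowth, Set.mem_univ, Set.mem_singleton_iff, exists_eq_left, true_and]
    exact Set.ncard_le_ncard hn (hc.finite_ball hl u n)
  have h2 : graphGrowth Γ U {u} (C * n + C) ≤ U.ncard :=
    Set.ncard_le_ncard (fun v hv => hv.1) hU
  have h3 := hC n
  have h4 := Nat.mul_le_mul_left C h2
  omega

end Fire

section Cayley

open scoped Pointwise

variable {G : Type} [Group G] {S : Set G}

lemma cayley_adj_mul {g t : G} : (cayley G S).Adj g (g * t) ↔ t ≠ 1 ∧ (t ∈ S ∨ t⁻¹ ∈ S) := by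
  simp [cayley, SimpleGraph.fromRel_adj]

lemma cayley_adj_iff {a b : G} :
    (cayley G S).Adj a b ↔ a⁻¹ * b ≠ 1 ∧ (a⁻¹ * b ∈ S ∨ (a⁻¹ * b)⁻¹ ∈ S) := by
  rw [← cayley_adj_mul (g := a), mul_inv_cancel_left]

/-- Left translation as an automorphism of the Cayley graph. -/
def cayleyTranslate (S : Set G) (g : G) : cayley G S ≃g cayley G S where
  toEquiv := Equiv.mulLeft g
  map_rel_iff' := by
    intro a b
    simp only [cayley_adj_iff, Equiv.coe_mulLeft, mul_inv_rev, mul_assoc, inv_mul_cancel_left]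

lemma locFinite_cayley (hS : S.Finite) : LocFinite (cayley G S) := by
  intro a
  refine ((hS.union hS.inv).image (a * ·)).subset fun b hb => ?_
  exact ⟨a⁻¹ * b, (cayley_adj_iff.mp hb).2, mul_inv_cancel_left a b⟩

lemma connected_cayley (hS : Subgroup.closure S = ⊤) : (cayley G S).Connected := by
  have htr : ∀ g {a b : G}, (cayley G S).Reachable a b →
      (cayley G S).Reachable (g * a) (g * b) :=
    fun g _ _ h => h.map (cayleyTranslate S g).toHom
  have h1 : ∀ g : G, (cayley G S).Reachable 1 g := by
    intro g
    have hg : g ∈ Subgroup.closure S := hS ▸ Subgroup.mem_top g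
    induction hg using Subgroup.closure_induction with
    | mem s hs =>
      by_cases h : s = 1
      · rw [h]
      · exact (cayley_adj_iff.mpr (by simp [h, hs])).reachable
    | one => rfl
    | mul g h _ _ hg hh => exact hg.trans (by simpa using htr g hh)
    | inv g _ hg => simpa using (htr g⁻¹ hg).symm
  exact ⟨fun a b => (h1 a).symm.trans (h1 b)⟩

lemma cayley_dist_mul_left (hS : Subgroup.closure S = ⊤) (g a b : G) :
    (cayley G S).dist (g * a) (g * b) = (cayley G S).dist a b := by
  have hle : ∀ g a b : G, (cayley G S).dist (g * a) (g * b) ≤ (cayley G S).dist a b := by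
    intro g a b
    obtain ⟨p, hp⟩ := (connected_cayley hS).exists_walk_length_eq_dist a b
    have := SimpleGraph.dist_le (p.map (cayleyTranslate S g).toHom)
    rwa [SimpleGraph.Walk.length_map, hp] at this
  exact (hle g a b).antisymm (by simpa using hle g⁻¹ (g * a) (g * b))

lemma ncard_ball_cayley (hS : Subgroup.closure S = ⊤) (x y : G) (n : ℕ) :
    {v | (cayley G S).dist x v ≤ n}.ncard = {v | (cayley G S).dist y v ≤ n}.ncard := by
  have h : {v | (cayley G S).dist y v ≤ n} =
      (fun v => y * x⁻¹ * v) '' {v | (cayley G S).dist x v ≤ n} := by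
    ext v
    refine ⟨fun hv => ⟨x * y⁻¹ * v, ?_, by group⟩, ?_⟩
    · have := cayley_dist_mul_left hS (x * y⁻¹) y v
      rw [inv_mul_cancel_right] at this
      exact this.trans_le hv
    · rintro ⟨w, hw, rfl⟩
      have := cayley_dist_mul_left hS (y * x⁻¹) x w
      rw [inv_mul_cancel_right] at this
      exact this.trans_le hw
  rw [h, Set.ncard_image_of_injective _ (mul_right_injective _)]

lemma closedOff_cayley_smul {K D : Set G} (h : (cayley G S).ClosedOff K D) (g : G) :
    (cayley G S).ClosedOff (g • K) (g • D) := by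
  intro u v hu huv hv
  rw [Set.mem_smul_set_iff_inv_smul_mem] at hu hv ⊢
  exact h hu ((cayleyTranslate S g⁻¹).map_adj_iff.mpr huv) hv

/-- Some translate of a finite set avoids a given finite set. -/
lemma exists_disjoint_smul [Infinite G] {K Y : Set G} (hK : K.Finite) (hY : Y.Finite) :
    ∃ g : G, Disjoint Y (g • K) := by
  obtain ⟨g, hg⟩ := (hY.mul hK.inv).exists_notMem
  refine ⟨g, Set.disjoint_left.mpr ?_⟩
  rintro _ hy ⟨k, hk, rfl⟩
  exact hg ⟨g * k, hy, k⁻¹, Set.inv_mem_inv.mpr hk, mul_inv_cancel_right g k⟩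

/-- In a non-amenable group, a constant number of fire fighters per step cannot contain every
fire. -/
lemma exists_finite_forall_burnedSet_infinite [Infinite G] (hna : ¬ IsAmenable G)
    (hS : IsFiniteGenSet S) (f : ℕ) :
    ∃ X0 : Set G, X0.Finite ∧ ∀ W, IsStrategyBound (fun _ => f) W →
      (burnedSet (cayley G S) 1 W X0).Infinite := by
  classical
  obtain ⟨T, hT⟩ := hS.1.exists_finset_coe
  obtain ⟨k, hk⟩ := exists_card_le_mul_card_boundary hna hS.2 hT.symm.subset
  obtain ⟨A, hA⟩ := Infinite.exists_subset_card_eq G (k * (f + 1) * (k + 1))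
  refine ⟨A, A.finite_toSet, fun W hW hfin => ?_⟩
  have hsub : ∀ n, fireSet (cayley G S) 1 W A n ⊆ burnedSet (cayley G S) 1 W A :=
    fun n => Set.subset_iUnion _ n
  choose X hX using fun n => (hfin.subset (hsub n)).exists_finset_coe
  have hgrow : ∀ n, (X n).card + ((X n * T) \ X n).card ≤ (X (n + 1)).card + f * (n + 1) := by
    intro n
    obtain ⟨hPfin, hPcard⟩ := hW.protectedUpTo_finite_ncard_le (n + 1)
    obtain ⟨P, hP⟩ := hPfin.exists_finset_coe
    rw [← hP, Set.ncard_coe_finset] at hPcard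
    have hss : X n ∪ ((X n * T) \ X n) ⊆ X (n + 1) ∪ P := by
      intro v hv
      by_cases hvP : v ∈ P
      · exact Finset.mem_union_right _ hvP
      refine Finset.mem_union_left _ ?_
      rw [← Finset.mem_coe, hX]
      by_cases hvX : v ∈ X n
      · rw [← Finset.mem_coe, hX] at hvX
        exact fireSet_subset_succ n hvX
      · obtain ⟨u, hu, t, ht, rfl⟩ := Finset.mem_mul.mp
          (Finset.mem_sdiff.mp ((Finset.mem_union.mp hv).resolve_left hvX)).1
        have hadj : (cayley G S).Adj u (u * t) :=
          cayley_adj_mul.mpr ⟨fun h => hvX (by rwa [h, mul_one]), Or.inl (hT ▸ ht)⟩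
        rw [← Finset.mem_coe, hX] at hu
        rw [← Finset.mem_coe, hP] at hvP
        exact mem_fireSet_succ_of_adj hu hadj hvP
    have h1 := Finset.card_le_card hss
    rw [Finset.card_union_of_disjoint Finset.disjoint_sdiff] at h1
    have h2 := Finset.card_union_le (X (n + 1)) P
    omega
  have hkpos : 0 < k := by
    have := hk {1}
    rw [Finset.card_singleton] at this
    exact Nat.pos_of_mul_pos_right (Nat.lt_of_lt_of_le one_pos this)
  have hcard : ∀ n, k * (f + 1) * (n + k + 1) ≤ (X n).card := by
    intro n
    induction n with
    | zero =>
      have : X 0 = A := Finset.coe_injective (hX 0)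
      rw [this, hA, zero_add]
    | succ n ih =>
      have h1 := hgrow n
      have h2 := ih.trans (hk (X n))
      rw [mul_assoc] at h2
      have h3 := Nat.le_of_mul_le_mul_left h2 hkpos
      nlinarith
  obtain ⟨B, hB⟩ := hfin.exists_finset_coe
  have h1 := hcard (B.card)
  have h2 : (X B.card).card ≤ B.card :=
    Finset.card_le_card (Finset.coe_subset.mp (by rw [hX, hB]; exact hsub _))
  have h3 : 1 ≤ k * (f + 1) := Nat.mul_pos hkpos (Nat.succ_pos f)
  nlinarith

/-- If a finite set separates two infinite components of the Cayley graph, then protecting a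
suitable translate of it retains a set of full growth. -/
lemma finiteStepRetainingProperty_of_componentCompl [Infinite G] (hS : IsFiniteGenSet S)
    {K : Finset G} {C C' : (cayley G S).ComponentCompl K} (hne : C ≠ C')
    (hC : C.supp.Infinite) (hC' : C'.supp.Infinite) :
    FiniteStepRetainingProperty (cayley G S) (fun _ => K.card) := by
  have hc := connected_cayley hS.2
  have hl := locFinite_cayley hS.1
  intro X0 hX0
  obtain ⟨n, hn⟩ := (cayley G S).exists_dist_le_of_finite 1 hX0
  obtain ⟨g, hg⟩ := exists_disjoint_smul K.finite_toSet (hc.finite_ball hl 1 n)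
  have hgK : ∀ v ∈ g • (K : Set G), n < (cayley G S).dist 1 v := fun v hv => by
    by_contra! h
    exact Set.disjoint_left.mp hg h hv
  obtain ⟨D, hDinf, hD, h1D⟩ : ∃ D : Set G, D.Infinite ∧ (cayley G S).ClosedOff K D ∧
      1 ∉ g • D := by
    by_cases h1 : (1 : G) ∈ g • (C : Set G)
    · refine ⟨C', hC', C'.closedOff, fun h1' => ?_⟩
      rw [Set.mem_smul_set_iff_inv_smul_mem] at h1 h1'
      exact Set.disjoint_left.mp
        (SimpleGraph.ComponentCompl.pairwise_disjoint hne) h1 h1'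
    · exact ⟨C, hC, C.closedOff, h1⟩
  have hgD := closedOff_cayley_smul hD g
  have hX0D : Disjoint X0 (g • D) := Set.disjoint_left.mpr fun x hx hxD =>
    h1D (hgD.center_mem hc hgK hxD (hn x hx))
  let W : ℕ → Set G := fun i => if i = 1 then g • (K : Set G) else ∅
  have hW : ∀ i, protectedUpTo W (i + 1) = g • (K : Set G) := by
    intro i
    ext v
    rw [mem_protectedUpTo]
    constructor
    · rintro ⟨j, -, -, hv⟩
      by_cases hj : j = 1
      · simpa [W, hj] using hv
      · simp [W, hj] at hv
    · exact fun hv => ⟨1, le_rfl, by omega, by simpa [W] using hv⟩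
  have hKfin : (g • (K : Set G)).Finite := K.finite_toSet.smul_set
  refine ⟨W, ⟨fun i _ => ?_, ?_⟩, 2, fun i hi => if_neg (by omega)⟩
  · by_cases hi : i = 1
    · simp only [W, hi, if_true]
      exact ⟨hKfin, by rw [Set.ncard_smul_set, Set.ncard_coe_finset]⟩
    · simp [W, hi]
  · exact hgD.growthEqFull hc hl (ncard_ball_cayley hS.2) hKfin
      ((Set.infinite_smul_set).mpr hDinf)
      (hgD.subset_compl_burnedSet hW (hg.mono_left hn) hX0D)

end Cayley

lemma infinite_of_not_isAmenable {G : Type} [Group G] (hna : ¬ IsAmenable G) : Infinite G := by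
  classical
  by_contra hfin
  rw [not_infinite_iff_finite] at hfin
  have := Fintype.ofFinite G
  obtain ⟨k, hk⟩ := exists_card_le_mul_card_boundary hna (S := Set.univ)
    Subgroup.closure_univ (T := Finset.univ) (by simp)
  have := hk Finset.univ
  simp at this

theorem stmt14 (G : Type) [Group G] (hna : ¬ IsAmenable G)
    (S : Set G) (hS : IsFiniteGenSet S) :
    (cayley G S).end.ncard = 1 ↔
      ¬ ∃ f : ℕ, FiniteStepRetainingProperty (cayley G S) (fun _ => f) := by
  have := infinite_of_not_isAmenable hna
  have hc := connected_cayley hS.2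
  have hl := locFinite_cayley hS.1
  have : Fact (cayley G S).Preconnected := ⟨hc.preconnected⟩
  let _ : (cayley G S).LocallyFinite := fun v => (hl v).fintype
  constructor
  · rintro hend ⟨f, hf⟩
    obtain ⟨X0, hX0, hburn⟩ := exists_finite_forall_burnedSet_infinite hna hS f
    obtain ⟨W, ⟨hW, hgrowth⟩, hstep⟩ := hf X0 hX0
    obtain ⟨P, hP, hWP⟩ := hstep.exists_finite_protectedUpTo_subset hW
    rcases SimpleGraph.finite_or_finite_compl_of_ncard_end_eq_one hend hP
      (closedOff_burnedSet hWP) with h | h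
    · exact hburn W hW h
    · exact hgrowth.infinite hc hl h
  · intro h
    by_contra hend
    obtain ⟨K, C, C', hne, hC, hC'⟩ := SimpleGraph.exists_ne_infinite_componentCompl hend
    exact h ⟨K.card, finiteStepRetainingProperty_of_componentCompl hS hne hC hC'⟩
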